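/- arXiv:1301.1512 — 2 statements merged into one kernel-verified Lean document; each statement's English description precedes it below -/
import Mathlib

section
/- Let G be a 2-connected graph which is not a cycle. If G contains no induced subgraph isomorphic to K_{1,3} and no induced subgraph isomorphic to Z_2, then G is pancyclic. -/
open SimpleGraph

/-- `G` contains a cycle of length `k`. -/
def HasCycleLength {V : Type} (G : SimpleGraph V) (k : ℕ) : Prop :=
  ∃ (v : V) (c : G.Walk v v), c.IsCycle ∧ c.length = k

/-- A graph on `n` vertices is pancyclic if it contains cycles of every length from 3 to `n`. -/
def IsPancyclic {V : Type} [Fintype V] (G : SimpleGraph V) : Prop :=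
  ∀ k : ℕ, 3 ≤ k → k ≤ Fintype.card V → HasCycleLength G k

/-- A graph is Hamiltonian if it contains a spanning cycle. -/
def IsHamiltonianGraph {V : Type} (G : SimpleGraph V) : Prop :=
  ∃ (v : V) (c : G.Walk v v), c.IsCycle ∧ ∀ u : V, u ∈ c.support

/-- A graph is 2-connected if it has at least 3 vertices and deleting any single
vertex leaves a connected graph. -/
def TwoConnected {V : Type} [Fintype V] (G : SimpleGraph V) : Prop :=
  3 ≤ Fintype.card V ∧ ∀ v : V, (G.induce {u : V | u ≠ v}).Connected

/-- A (finite) graph is a cycle iff it is connected and 2-regular. -/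
def IsCycleGraph {V : Type} [Fintype V] (G : SimpleGraph V) [DecidableRel G.Adj] : Prop :=
  G.Connected ∧ ∀ v : V, G.degree v = 2

/-- `G` is `R`-f₁-heavy: for every induced copy of `R` in `G` (given by a graph
embedding `f : R ↪g G`) and every pair of vertices at distance 2 in that copy,
one of them has degree at least `(n+1)/2` in `G`. -/
def F1Heavy {V W : Type} [Fintype V] (G : SimpleGraph V) [DecidableRel G.Adj]
    (R : SimpleGraph W) : Prop :=
  ∀ (f : R ↪g G) (a b : W), R.dist a b = 2 →
    Fintype.card V + 1 ≤ 2 * max (G.degree (f a)) (G.degree (f b))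

/-- `G` is `R`-f-heavy: as above but with degree at least `n/2`. -/
def FHeavy {V W : Type} [Fintype V] (G : SimpleGraph V) [DecidableRel G.Adj]
    (R : SimpleGraph W) : Prop :=
  ∀ (f : R ↪g G) (a b : W), R.dist a b = 2 →
    Fintype.card V ≤ 2 * max (G.degree (f a)) (G.degree (f b))

/-- `G` is `R`-free: no induced subgraph of `G` is isomorphic to `R`. -/
def RFree {V W : Type} (G : SimpleGraph V) (R : SimpleGraph W) : Prop :=
  IsEmpty (R ↪g G)

/-- The claw `K_{1,3}`: vertex `0` is the center, adjacent to `1`, `2`, `3`. -/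
def claw : SimpleGraph (Fin 4) := SimpleGraph.fromRel (fun a _ => a = 0)

/-- `Z_i`: the path `0 1 2 ... (i+2)` together with the chord `{0,2}`,
i.e. a triangle `0 1 2` with a path of `i` edges attached at vertex `2`. -/
def Zgraph (i : ℕ) : SimpleGraph (Fin (i + 3)) :=
  SimpleGraph.fromRel (fun a b => b.val = a.val + 1 ∨ (a.val = 0 ∧ b.val = 2))

/-- The net `N`: triangle `0 1 2` with pendant edges `0-3`, `1-4`, `2-5`. -/
def netGraph : SimpleGraph (Fin 6) :=
  SimpleGraph.fromRel (fun a b =>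
    (a.val = 0 ∧ b.val = 1) ∨ (a.val = 1 ∧ b.val = 2) ∨ (a.val = 0 ∧ b.val = 2) ∨
    (a.val = 0 ∧ b.val = 3) ∨ (a.val = 1 ∧ b.val = 4) ∨ (a.val = 2 ∧ b.val = 5))

/-- The wounded `W`: triangle `0 1 2` with a pendant edge `0-3` and a pendant
path `1-4-5` of two edges. -/
def woundedGraph : SimpleGraph (Fin 6) :=
  SimpleGraph.fromRel (fun a b =>
    (a.val = 0 ∧ b.val = 1) ∨ (a.val = 1 ∧ b.val = 2) ∨ (a.val = 0 ∧ b.val = 2) ∨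
    (a.val = 0 ∧ b.val = 3) ∨ (a.val = 1 ∧ b.val = 4) ∨ (a.val = 4 ∧ b.val = 5))

section helpers
variable {V : Type} {G : SimpleGraph V}

lemma claw_elim (h : RFree G claw) {v a b c : V} (ha : G.Adj v a) (hb : G.Adj v b)
    (hc : G.Adj v c) (hab : a ≠ b) (hac : a ≠ c) (hbc : b ≠ c) :
    G.Adj a b ∨ G.Adj a c ∨ G.Adj b c := by
  by_contra! hcon
  obtain ⟨h1, h2, h3⟩ := hcon
  refine h.false ⟨⟨![v, a, b, c], ?_⟩, ?_⟩
  · intro i j hij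
    have := ha.ne; have := hb.ne; have := hc.ne
    fin_cases i <;> fin_cases j <;> simp_all
  · intro i j
    have := ha.symm; have := hb.symm; have := hc.symm
    have := fun h => h1 (G.adj_symm h)
    have := fun h => h2 (G.adj_symm h)
    have := fun h => h3 (G.adj_symm h)
    clear h
    change G.Adj (![v, a, b, c] i) (![v, a, b, c] j) ↔ _
    rw [claw, SimpleGraph.fromRel_adj]
    fin_cases i <;> fin_cases j <;> simp [*] <;> assumption

lemma Z2_elim (h : RFree G (Zgraph 2)) {p q r s t : V} (hpq : G.Adj p q)
    (hpr : G.Adj p r) (hqr : G.Adj q r) (hrs : G.Adj r s) (hst : G.Adj s t)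
    (hsp : s ≠ p) (hsq : s ≠ q) (htr : t ≠ r) :
    G.Adj p s ∨ G.Adj q s ∨ G.Adj p t ∨ G.Adj q t ∨ G.Adj r t := by
  by_contra! hcon
  obtain ⟨h1, h2, h3, h4, h5⟩ := hcon
  have e1 : t ≠ p := by rintro rfl; exact h1 hst.symm
  have e2 : t ≠ q := by rintro rfl; exact h2 hst.symm
  refine h.false ⟨⟨![p, q, r, s, t], ?_⟩, ?_⟩
  · intro i j hij
    have := hpq.ne; have := hpr.ne; have := hqr.ne; have := hrs.ne; have := hst.ne
    have := hpq.ne'; have := hpr.ne'; have := hqr.ne'; have := hrs.ne'; have := hst.ne'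
    have := e1.symm; have := e2.symm; have := hsp.symm; have := hsq.symm; have := htr.symm
    fin_cases i <;> fin_cases j <;> simp_all
  · intro i j
    have := hpq.symm; have := hpr.symm; have := hqr.symm; have := hrs.symm; have := hst.symm
    have := fun h => h1 (G.adj_symm h)
    have := fun h => h2 (G.adj_symm h)
    have := fun h => h3 (G.adj_symm h)
    have := fun h => h4 (G.adj_symm h)
    have := fun h => h5 (G.adj_symm h)
    clear h
    change G.Adj (![p, q, r, s, t] i) (![p, q, r, s, t] j) ↔ _
    rw [Zgraph, SimpleGraph.fromRel_adj]
    fin_cases i <;> fin_cases j <;> simp [*] <;> assumption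

/-- `l` lists the vertices of a walk from `s` to `t`. -/
def Pth (G : SimpleGraph V) (s t : V) (l : List V) : Prop :=
  ∃ p : G.Walk s t, p.support = l

lemma Pth.single (s : V) : Pth G s s [s] := ⟨.nil, rfl⟩

lemma Pth.app {s t s' t' : V} {l l' : List V} (h : Pth G s t l) (e : G.Adj t s')
    (h' : Pth G s' t' l') : Pth G s t' (l ++ l') := by
  obtain ⟨p, rfl⟩ := h
  obtain ⟨q, rfl⟩ := h'
  exact ⟨p.append (.cons e q), by simp [Walk.support_append]⟩

lemma Pth.cons {s s' t' : V} {l' : List V} (e : G.Adj s s')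
    (h' : Pth G s' t' l') : Pth G s t' (s :: l') := (Pth.single s).app e h'

lemma Pth.rev {s t : V} {l : List V} (h : Pth G s t l) : Pth G t s l.reverse := by
  obtain ⟨p, rfl⟩ := h
  exact ⟨p.reverse, by simp⟩

lemma Pth.left {s t : V} {l : List V} (h : Pth G s t l) : s ∈ l := by
  obtain ⟨p, rfl⟩ := h
  exact p.start_mem_support

lemma Pth.right {s t : V} {l : List V} (h : Pth G s t l) : t ∈ l := by
  obtain ⟨p, rfl⟩ := h
  exact p.end_mem_support

/-- decompose a walk at its first vertex -/
lemma Pth.uncons {s t : V} {l : List V} (h : Pth G s t l) :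
    (s = t ∧ l = [s]) ∨ ∃ s' l', G.Adj s s' ∧ Pth G s' t l' ∧ l = s :: l' := by
  obtain ⟨p, rfl⟩ := h
  cases p with
  | nil => left; simp
  | cons e q => right; exact ⟨_, _, e, ⟨q, rfl⟩, by simp⟩

lemma Pth.split {s t w : V} {l : List V} (h : Pth G s t l) (hw : w ∈ l) (hws : w ≠ s)
    (hwt : w ≠ t) : ∃ a b A B, Pth G s a A ∧ Pth G b t B ∧ G.Adj a w ∧ G.Adj w b ∧
      l = A ++ w :: B := by
  obtain ⟨p, rfl⟩ := h
  induction p with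
  | nil => simp at hw; exact absurd hw hws
  | @cons u v t e q ih =>
    have hw' : w ∈ q.support := by
      simpa [hws] using hw
    by_cases hwv : w = v
    · subst hwv
      rcases Pth.uncons (l := q.support) ⟨q, rfl⟩ with ⟨h1, -⟩ | ⟨s', l', h1, h2, h3⟩
      · exact absurd h1 hwt
      · exact ⟨u, s', [u], l', .single u, h2, e, h1, by simp [h3]⟩
    · obtain ⟨a, b, A, B, hA, hB, h1, h2, h3⟩ := ih hwv hwt hw'
      exact ⟨a, b, u :: A, B, hA.cons e, hB, h1, h2, by simp [h3]⟩

lemma Pth.hasCycle {s t : V} {l : List V} (h : Pth G s t l) (e : G.Adj t s) (hn : l.Nodup)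
    (hl : 3 ≤ l.length) : HasCycleLength G l.length := by
  obtain ⟨p, rfl⟩ := h
  refine ⟨t, .cons e p, ?_, by simp⟩
  have hp : p.IsPath := (Walk.isPath_def p).2 hn
  rw [Walk.cons_isCycle_iff]
  refine ⟨hp, fun hmem => ?_⟩
  cases p with
  | nil => simp at hl
  | @cons _ b _ e' q =>
    rw [Walk.cons_isPath_iff] at hp
    rw [Walk.edges_cons, List.mem_cons] at hmem
    rcases hmem with hm | hm
    · have : b = t := by
        have := e.ne
        simp at hm; grind
      subst this
      have := Walk.isPath_iff_eq_nil.1 hp.1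
      subst this
      simp at hl
    · exact hp.2 (Walk.snd_mem_support_of_mem_edges _ hm)

lemma hasCycle_list {k : ℕ} (h : HasCycleLength G k) (hk : 3 ≤ k) :
    ∃ s t l, Pth G s t l ∧ G.Adj t s ∧ l.Nodup ∧ l.length = k := by
  obtain ⟨v, c, hc, rfl⟩ := h
  cases c with
  | nil => simp at hk
  | cons e p =>
    rw [Walk.cons_isCycle_iff] at hc
    exact ⟨_, _, _, ⟨p, rfl⟩, e, hc.1.support_nodup, by simp⟩

/-- a cycle can be started at any of its vertices -/
lemma rotate_cyc {s t v : V} {l : List V} (h : Pth G s t l) (e : G.Adj t s) (hv : v ∈ l)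
    (hl : 3 ≤ l.length) :
    ∃ a b A, Pth G a b A ∧ G.Adj v a ∧ G.Adj b v ∧ l.Perm (v :: A) := by
  by_cases h1 : v = s
  · subst h1
    rcases h.uncons with ⟨rfl, rfl⟩ | ⟨s', l', h1, h2, rfl⟩
    · simp at hl
    · exact ⟨_, _, _, h2, h1, e, .refl _⟩
  by_cases h2 : v = t
  · subst h2
    rcases h.rev.uncons with ⟨rfl, -⟩ | ⟨s', l', h3, h4, h5⟩
    · exact absurd rfl h1
    · refine ⟨_, _, _, h4.rev, e, h3.symm, ?_⟩
      have : l.Perm l.reverse := l.reverse_perm.symm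
      rw [h5] at this
      exact this.trans (List.Perm.cons _ l'.reverse_perm.symm)
  obtain ⟨a, b, A, B, hA, hB, h3, h4, rfl⟩ := h.split hv h1 h2
  refine ⟨_, _, _, hB.app e hA, h4, h3, ?_⟩
  exact List.perm_middle.trans (List.Perm.cons _ List.perm_append_comm)

/-- the case of an outside vertex with two neighbours on the cycle -/
lemma ext_two (hclaw : RFree G claw) (hZ : RFree G (Zgraph 2)) {x v w a a' b b' : V}
    {A B : List V} (hA : Pth G a a' A) (hB : Pth G b b' B) (hva : G.Adj v a)
    (haw : G.Adj a' w) (hwb : G.Adj w b) (hbv : G.Adj b' v) (hxv : G.Adj x v)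
    (hxw : G.Adj x w) (hn : (x :: v :: w :: (A ++ B)).Nodup) :
    HasCycleLength G (A.length + B.length + 3) := by
  by_contra hno
  have no : ∀ s t l, Pth G s t l → G.Adj t s → l.Perm (x :: v :: w :: (A ++ B)) → False := by
    intro s t l h e hp
    apply hno
    have := h.hasCycle e (hp.nodup_iff.2 hn) (by rw [hp.length_eq]; simp)
    rw [hp.length_eq] at this
    simpa using this
  have hal := hA.left
  have har := hA.right
  have hbl := hB.left
  have hbr := hB.right
  have hn' := hn
  simp only [List.nodup_cons, List.nodup_append, List.mem_cons, List.mem_append, not_or] at hn'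
  obtain ⟨⟨nxv, nxw, nxA, nxB⟩, ⟨nvw, nvA, nvB⟩, ⟨nwA, nwB⟩, ndA, ndB, nAB⟩ := hn'
  have pv : Pth G v v [v] := .single v
  have pw : Pth G w w [w] := .single w
  have px : Pth G x x [x] := .single x
  have vx := hxv.symm
  have wx := hxw.symm
  have ne1 : ∀ y ∈ A, y ≠ x ∧ y ≠ v ∧ y ≠ w := by grind
  have ne2 : ∀ y ∈ B, y ≠ x ∧ y ≠ v ∧ y ≠ w := by grind
  -- insertion
  have xa : ¬ G.Adj x a := fun e => no _ _ _
    ((((px.app e hA).app haw pw).app hwb hB).app hbv pv) vx (by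
      classical
      rw [List.perm_iff_count]; intro z; simp [List.count_cons]; grind)
  have xa' : ¬ G.Adj x a' := fun e => no _ _ _
    ((((px.app e hA.rev).app hva.symm pv).app hbv.symm hB.rev).app hwb.symm pw) wx (by
      classical
      rw [List.perm_iff_count]; intro z; simp [List.count_cons]; grind)
  have xb : ¬ G.Adj x b := fun e => no _ _ _
    ((((px.app e hB).app hbv pv).app hva hA).app haw pw) wx (by
      classical
      rw [List.perm_iff_count]; intro z; simp [List.count_cons]; grind)
  have xb' : ¬ G.Adj x b' := fun e => no _ _ _
    ((((px.app e hB.rev).app hwb.symm pw).app haw.symm hA.rev).app hva.symm pv) vx (by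
      classical
      rw [List.perm_iff_count]; intro z; simp [List.count_cons]; grind)
  have ab' : G.Adj a b' := by
    have := claw_elim hclaw vx hva hbv.symm (ne1 _ hal).1.symm (ne2 _ hbr).1.symm
      (nAB _ hal _ hbr)
    tauto
  have a'b : G.Adj a' b := by
    have := claw_elim hclaw wx haw.symm hwb (ne1 _ har).1.symm (ne2 _ hbl).1.symm
      (nAB _ har _ hbl)
    tauto
  have vb : ¬ G.Adj v b := fun e => no _ _ _
    ((((px.app hxv pv).app e hB).app ab'.symm hA).app haw pw) wx (by
      classical
      rw [List.perm_iff_count]; intro z; simp [List.count_cons]; grind)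
  have va' : ¬ G.Adj v a' := fun e => no _ _ _
    ((((px.app hxv pv).app e hA.rev).app ab' hB.rev).app hwb.symm pw) wx (by
      classical
      rw [List.perm_iff_count]; intro z; simp [List.count_cons]; grind)
  have wb' : ¬ G.Adj w b' := fun e => no _ _ _
    ((((px.app hxw pw).app e hB.rev).app a'b.symm hA.rev).app hva.symm pv) vx (by
      classical
      rw [List.perm_iff_count]; intro z; simp [List.count_cons]; grind)
  have wa : ¬ G.Adj w a := fun e => no _ _ _
    ((((px.app hxw pw).app e hA).app a'b hB).app hbv pv) vx (by
      classical
      rw [List.perm_iff_count]; intro z; simp [List.count_cons]; grind)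
  have ab : ¬ G.Adj a b := fun e => no _ _ _
    ((((px.app hxw pw).app haw.symm hA.rev).app e hB).app hbv pv) vx (by
      classical
      rw [List.perm_iff_count]; intro z; simp [List.count_cons]; grind)
  have a'b' : ¬ G.Adj a' b' := fun e => no _ _ _
    ((((px.app hxv pv).app hva hA).app e hB.rev).app hwb.symm pw) wx (by
      classical
      rw [List.perm_iff_count]; intro z; simp [List.count_cons]; grind)
  have vw : G.Adj v w := by
    have := Z2_elim hZ ab' hva.symm hbv vx hxw (ne1 _ hal).1.symm (ne2 _ hbr).1.symm
      (Ne.symm nvw)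
    simp only [G.adj_comm a x, G.adj_comm b' x, G.adj_comm a w, G.adj_comm b' w] at this
    tauto
  have aa' : G.Adj a a' := by
    have := Z2_elim hZ ab' hva.symm hbv vw haw.symm (ne1 _ hal).2.2.symm (ne2 _ hbr).2.2.symm
      (ne1 _ har).2.1
    simp only [G.adj_comm a w, G.adj_comm b' w, G.adj_comm b' a'] at this
    tauto
  rcases hA.uncons with ⟨rfl, -⟩ | ⟨c, A', hac, hA', rfl⟩
  · exact aa'.ne rfl
  have pa : Pth G a a [a] := .single a
  have hcl := hA'.left
  have vc : ¬ G.Adj v c := fun e => no _ _ _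
    (((((px.app hxv pv).app e hA').app aa'.symm pa).app ab' hB.rev).app hwb.symm pw) wx (by
      classical
      rw [List.perm_iff_count]; intro z; simp [List.count_cons]; grind)
  have bc : ¬ G.Adj b c := fun e => no _ _ _
    (((((px.app hxv pv).app hva pa).app ab' hB.rev).app e hA').app haw pw) wx (by
      classical
      rw [List.perm_iff_count]; intro z; simp [List.count_cons]; grind)
  have xc : ¬ G.Adj x c := fun e => no _ _ _
    (((((px.app e hA').app haw pw).app hwb hB).app ab'.symm pa).app hva.symm pv) vx (by
      classical
      rw [List.perm_iff_count]; intro z; simp [List.count_cons]; grind)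
  have nc := ne1 c (List.mem_cons_of_mem _ hcl)
  have wc : G.Adj w c := by
    have := Z2_elim hZ hxw hxv vw.symm hva hac (ne1 _ hal).1 (ne1 _ hal).2.2 nc.2.1
    tauto
  have := claw_elim hclaw wx wc hwb nc.1.symm (ne2 _ hbl).1.symm
    (nAB _ (List.mem_cons_of_mem _ hcl) _ hbl)
  rw [G.adj_comm c b] at this
  tauto

/-- the case of two adjacent outside vertices attached at consecutive cycle vertices -/
lemma ext_pair (hclaw : RFree G claw) (hZ : RFree G (Zgraph 2)) {x y v w b b' : V}
    {B : List V} (hB : Pth G b b' B) (hvw : G.Adj v w) (hwb : G.Adj w b) (hbv : G.Adj b' v)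
    (hxv : G.Adj x v) (hyw : G.Adj y w) (hxy : G.Adj x y)
    (hn : (x :: y :: v :: w :: B).Nodup)
    (hx : ∀ u ∈ v :: w :: B, G.Adj x u → u = v) (hy : ∀ u ∈ v :: w :: B, G.Adj y u → u = w) :
    HasCycleLength G (B.length + 3) := by
  have hbl := hB.left
  have hbr := hB.right
  simp only [List.nodup_cons, List.mem_cons, not_or] at hn
  obtain ⟨⟨nxy, nxv, nxw, nxB⟩, ⟨nyv, nyw, nyB⟩, ⟨nvw, nvB⟩, nwB, ndB⟩ := hn
  have ne : ∀ u ∈ B, u ≠ x ∧ u ≠ y ∧ u ≠ v ∧ u ≠ w := by grind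
  have hxB : ∀ u ∈ B, ¬ G.Adj x u := fun u hu h => (ne u hu).2.2.1 (hx u (by simp [hu]) h)
  have hyB : ∀ u ∈ B, ¬ G.Adj y u := fun u hu h => (ne u hu).2.2.2 (hy u (by simp [hu]) h)
  have hxw : ¬ G.Adj x w := fun h => nvw (hx w (by simp) h).symm
  have hyv : ¬ G.Adj y v := fun h => nvw (hy v (by simp) h)
  by_cases hbb : b = b'
  · subst hbb
    rcases hB.uncons with ⟨-, rfl⟩ | ⟨c, B', -, h2, rfl⟩
    · exact (((Pth.single v).cons hxv).app hvw ((Pth.single y).cons hyw.symm)).hasCycle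
        hxy.symm (by simp; grind) (by simp)
    · simp only [List.nodup_cons] at ndB
      exact absurd h2.right ndB.1
  exfalso
  have vb : G.Adj v b := by
    have := claw_elim hclaw hyw.symm hvw.symm hwb nyv (ne _ hbl).2.1.symm (ne _ hbl).2.2.1.symm
    have := hyB b hbl
    tauto
  have bb' : G.Adj b b' := by
    have := claw_elim hclaw hxv.symm vb hbv.symm (ne _ hbl).1.symm (ne _ hbr).1.symm hbb
    have := hxB b hbl
    have := hxB b' hbr
    tauto
  have := Z2_elim hZ bb' vb.symm hbv hxv.symm hxy (ne _ hbl).1.symm (ne _ hbr).1.symm nyv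
  simp only [G.adj_comm _ x, G.adj_comm _ y] at this
  have := hxB b hbl
  have := hxB b' hbr
  have := hyB b hbl
  have := hyB b' hbr
  tauto

lemma two_conn_closed [Fintype V] (h2 : TwoConnected G) (z : V) (S : Set V)
    (hS : ∀ p q, p ∈ S → p ≠ z → q ≠ z → G.Adj p q → q ∈ S) {a b : V} (ha : a ∈ S)
    (haz : a ≠ z) (hbz : b ≠ z) : b ∈ S := by
  obtain ⟨p⟩ := (h2.2 z).preconnected ⟨a, haz⟩ ⟨b, hbz⟩
  have key : ∀ (u w : {u : V | u ≠ z}) (_ : (G.induce {u : V | u ≠ z}).Walk u w),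
      (u : V) ∈ S → (w : V) ∈ S := by
    intro u w p
    induction p with
    | nil => exact id
    | @cons u v w e q ih => exact fun hu => ih (hS _ _ hu u.2 v.2 e)
  exact key _ _ p ha

lemma extend [Fintype V] (h2 : TwoConnected G) (hclaw : RFree G claw)
    (hZ : RFree G (Zgraph 2)) {k : ℕ} (hk : 3 ≤ k) (hkn : k < Fintype.card V)
    (hc : HasCycleLength G k) : HasCycleLength G (k + 1) := by
  obtain ⟨s, t, l, hl, hts, hn, hlen⟩ := hasCycle_list hc hk
  by_contra hno
  -- outside vertices have at most one neighbour on the cycle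
  have uniq : ∀ x v w, x ∉ l → v ∈ l → w ∈ l → G.Adj x v → G.Adj x w → w = v := by
    intro x v w hx hv hw hxv hxw
    by_contra hne
    obtain ⟨a, b, A, hA, hva, hbv, hp⟩ := rotate_cyc hl hts hv (by omega)
    have hw' : w ∈ A := by
      have := hp.mem_iff.1 hw; simpa [hne] using this
    have hnn : (x :: v :: A).Nodup := by
      rw [List.nodup_cons, ← hp.mem_iff, ← hp.nodup_iff]; exact ⟨hx, hn⟩
    have hl2 : A.length + 1 = k := by
      have := hp.length_eq; simp at this; omega
    by_cases hwa : w = a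
    · subst hwa
      apply hno
      have h3 := ((hA.app hbv (Pth.single v)).app hxv.symm (Pth.single x)).hasCycle hxw
        (by
          have : (A ++ [v] ++ [x]).Perm (x :: v :: A) := by
            classical
            rw [List.perm_iff_count]; intro z; simp [List.count_cons]; grind
          exact this.nodup_iff.2 hnn) (by simp; omega)
      subst hl2
      simpa using h3
    by_cases hwb : w = b
    · subst hwb
      apply hno
      have h3 := ((hA.rev.app hva.symm (Pth.single v)).app hxv.symm (Pth.single x)).hasCycle hxw
        (by
          have : (A.reverse ++ [v] ++ [x]).Perm (x :: v :: A) := by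
            classical
            rw [List.perm_iff_count]; intro z; simp [List.count_cons]; grind
          exact this.nodup_iff.2 hnn) (by simp; omega)
      subst hl2
      simpa using h3
    obtain ⟨c, d, A1, A2, h1, h3, h4, h5, rfl⟩ := hA.split hw' hwa hwb
    apply hno
    have := ext_two hclaw hZ h1 h3 hva h4 h5 hbv hxv hxw (by
      have : (x :: v :: w :: (A1 ++ A2)).Perm (x :: v :: (A1 ++ w :: A2)) :=
        ((List.perm_middle.symm).cons _).cons _
      exact this.nodup_iff.2 hnn)
    convert this using 1
    simp at hl2; omega
  -- adjacent outside vertices share neighbours on the cycle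
  have share : ∀ x y v, x ∉ l → y ∉ l → v ∈ l → G.Adj x v → G.Adj x y → G.Adj y v := by
    intro x y v hx hy hv hxv hxy
    by_contra hyv
    obtain ⟨a, b, A, hA, hva, hbv, hp⟩ := rotate_cyc hl hts hv (by omega)
    have hnn : (x :: y :: v :: A).Nodup := by
      rw [List.nodup_cons, List.nodup_cons, List.mem_cons, ← hp.mem_iff, ← hp.mem_iff,
        ← hp.nodup_iff]
      exact ⟨by simp [hx, hxy.ne], hy, hn⟩
    have hl2 : A.length + 1 = k := by
      have := hp.length_eq; simp at this; omega
    have hAl : ∀ u, u ∈ v :: A → u ∈ l := fun u hu => hp.mem_iff.2 hu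
    have hnv : v ∉ A := by
      have := hp.nodup_iff.1 hn
      simp only [List.nodup_cons] at this; exact this.1
    have hxA : ∀ u ∈ A, ¬ G.Adj x u := by
      intro u hu h
      have := uniq x v u hx hv (hAl u (by simp [hu])) hxv h
      subst this; exact hnv hu
    have hab : a ≠ b := by
      rintro rfl
      rcases hA.uncons with ⟨-, rfl⟩ | ⟨c, B', -, h2, rfl⟩
      · simp at hl2; omega
      · simp only [List.nodup_cons] at hnn
        exact absurd h2.right hnn.2.2.2.1
    have nax : a ≠ x := by rintro rfl; exact hx (hAl _ (by simp [hA.left]))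
    have nbx : b ≠ x := by rintro rfl; exact hx (hAl _ (by simp [hA.right]))
    have hab' : G.Adj a b := by
      have := claw_elim hclaw hxv.symm hva hbv.symm nax.symm nbx.symm hab
      have := hxA a hA.left
      have := hxA b hA.right
      tauto
    have nyv : y ≠ v := by rintro rfl; exact hy hv
    have hz := Z2_elim hZ hab' hva.symm hbv hxv.symm hxy nax.symm nbx.symm nyv
    have hyab : G.Adj y a ∨ G.Adj y b := by
      have := hxA a hA.left
      have := hxA b hA.right
      simp only [G.adj_comm _ x, G.adj_comm _ y] at hz
      tauto
    apply hno
    have hxu : ∀ u ∈ v :: A, G.Adj x u → u = v :=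
      fun u hu h => uniq x v u hx hv (hAl u hu) hxv h
    rcases hyab with hya | hyb
    · rcases hA.uncons with ⟨h, -⟩ | ⟨c, B, hac, hB, rfl⟩
      · exact absurd h hab
      · have := ext_pair hclaw hZ hB hva hac hbv hxv hya hxy hnn hxu
          (fun u hu h => uniq y a u hy (hAl _ (by simp)) (hAl u hu) hya h)
        convert this using 1
        simp at hl2; omega
    · have hpr : (v :: A).Perm (v :: A.reverse) := A.reverse_perm.symm.cons _
      rcases hA.rev.uncons with ⟨h, -⟩ | ⟨c, B, hac, hB, he⟩
      · exact absurd h.symm hab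
      · rw [he] at hpr
        have := ext_pair hclaw hZ hB hbv.symm hac hva.symm hxv hyb hxy
          (((hpr.cons _).cons _).nodup_iff.1 hnn)
          (fun u hu h => hxu u (hpr.mem_iff.2 hu) h)
          (fun u hu h => uniq y b u hy (hAl _ (by simp [hA.right])) (hAl u (hpr.mem_iff.2 hu))
            hyb h)
        convert this using 1
        have := hpr.length_eq
        simp at hl2 this; omega
  obtain ⟨o, ho⟩ : ∃ o, o ∉ l := by
    by_contra! hall
    classical
    have : Finset.univ ⊆ l.toFinset := fun u _ => by simp [hall u]
    have := Finset.card_le_card this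
    have := l.toFinset_card_le
    rw [Finset.card_univ] at *
    omega
  -- two further vertices of the cycle
  have other : ∀ v ∈ l, ∃ u ∈ l, u ≠ v := by
    intro v hv
    obtain ⟨a, b, A, hA, hva, hbv, hp⟩ := rotate_cyc hl hts hv (by omega)
    exact ⟨a, hp.mem_iff.2 (by simp [hA.left]), hva.ne'⟩
  obtain ⟨x, v, hx, hv, hxv⟩ : ∃ x v, x ∉ l ∧ v ∈ l ∧ G.Adj x v := by
    by_contra! hnone
    obtain ⟨u, hu, hus⟩ := other s hl.left
    exact ho (two_conn_closed h2 s {p | p ∈ l} (fun p q hp _ _ e => by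
      by_contra hq; exact hnone q p hq hp e.symm) hu hus (by
        rintro rfl; exact ho hl.left))
  obtain ⟨u, hu, huv⟩ := other v hv
  have := two_conn_closed h2 v {p | p ∉ l ∧ G.Adj p v} (fun p q hp _ hq e => by
    obtain ⟨hp1, hp2⟩ := hp
    have hql : q ∉ l := fun h => hq (uniq p v q hp1 hv h hp2 e)
    exact ⟨hql, share p q v hp1 hql hv hp2 e⟩) (a := x) (b := u) ⟨hx, hxv⟩ hxv.ne huv
  exact this.1 hu

lemma exists_third [Fintype V] (h : 3 ≤ Fintype.card V) (a b : V) : ∃ z, z ≠ a ∧ z ≠ b := by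
  classical
  by_contra! hall
  have : Finset.univ ⊆ ({a, b} : Finset V) := fun u _ => by
    by_cases hu : u = a
    · simp [hu]
    · simp [hall u hu]
  have := Finset.card_le_card this
  have := Finset.card_le_two (a := a) (b := b)
  rw [Finset.card_univ] at *
  omega

lemma two_conn_connected [Fintype V] (h2 : TwoConnected G) : G.Connected := by
  have : Nonempty V := Fintype.card_pos_iff.1 (by have := h2.1; omega)
  refine ⟨fun u w => ?_⟩
  obtain ⟨z, hzu, hzw⟩ := exists_third h2.1 u w
  exact two_conn_closed h2 z {p | G.Reachable u p}
    (fun p q hp _ _ e => Reachable.trans hp e.reachable) (Reachable.refl u) hzu.symm hzw.symm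

lemma exists_triangle [Fintype V] [DecidableRel G.Adj] (h2 : TwoConnected G)
    (hnc : ¬ IsCycleGraph G) (hclaw : RFree G claw) : HasCycleLength G 3 := by
  by_contra hno
  have tri : ∀ a b c, G.Adj a b → G.Adj b c → ¬ G.Adj c a := by
    intro a b c h1 h3 h4
    exact hno ((((Pth.single c).cons h3).cons h1).hasCycle h4
      (by simp [h1.ne, h3.ne, h4.ne']) (by simp))
  refine hnc ⟨two_conn_connected h2, fun v => ?_⟩
  have hle : G.degree v ≤ 2 := by
    by_contra! hgt
    rw [← G.card_neighborFinset_eq_degree, Finset.two_lt_card] at hgt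
    obtain ⟨a, ha, b, hb, c, hc, hab, hac, hbc⟩ := hgt
    simp only [mem_neighborFinset] at ha hb hc
    rcases claw_elim hclaw ha hb hc hab hac hbc with h | h | h
    · exact tri _ _ _ ha h hb.symm
    · exact tri _ _ _ ha h hc.symm
    · exact tri _ _ _ hb h hc.symm
  have hge : 2 ≤ G.degree v := by
    by_contra! hlt
    obtain ⟨z, hzv, hz⟩ : ∃ z, z ≠ v ∧ ∀ q, G.Adj v q → q = z := by
      have : (G.neighborFinset v).card ≤ 1 := by
        rw [G.card_neighborFinset_eq_degree]; omega
      rw [Finset.card_le_one] at this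
      by_cases hex : ∃ q, G.Adj v q
      · obtain ⟨q, hq⟩ := hex
        exact ⟨q, hq.ne', fun r hr => this r (by simpa using hr) q (by simpa using hq)⟩
      · obtain ⟨z, hz, -⟩ := exists_third h2.1 v v
        exact ⟨z, hz, fun q hq => absurd ⟨q, hq⟩ hex⟩
    obtain ⟨u, huv, huz⟩ := exists_third h2.1 v z
    exact huv (two_conn_closed h2 z {v} (fun p q hp _ hq e => by
      rw [Set.mem_singleton_iff] at hp
      subst hp
      exact absurd (hz q e) hq) (Set.mem_singleton v) hzv.symm huz)
  omega

end helpers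

theorem pancyclic_of_claw_Z2_free {V : Type} [Fintype V] (G : SimpleGraph V)
    [DecidableRel G.Adj] (h2 : TwoConnected G) (hnc : ¬ IsCycleGraph G)
    (hclaw : RFree G claw) (hZ2 : RFree G (Zgraph 2)) :
    IsPancyclic G := by
  intro k hk
  induction k, hk using Nat.le_induction with
  | base => exact fun _ => exists_triangle h2 hnc hclaw
  | succ k hk ih => exact fun hkn => extend h2 hclaw hZ2 hk (by omega) (ih (by omega))
end

section
/- Let G be a 2-connected graph. If G is both K_{1,3}-f-heavy and Z_2-f-heavy, then G is Hamiltonian. -/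
open SimpleGraph

/-! ### Paths with prescribed vertex set -/

/-- `Pth R a b S`: there is an `R`-path from `a` to `b` with vertex set exactly `S`. -/
inductive Pth_s14 {V : Type} [DecidableEq V] (R : V → V → Prop) : V → V → Finset V → Prop
  | single (a : V) : Pth_s14 R a a {a}
  | cons {a b c : V} {S : Finset V} : R a b → Pth_s14 R b c S → a ∉ S → Pth_s14 R a c (insert a S)

/-- Paths along `R`-edges and `B`-edges, where the `B`-edges are counted. -/
inductive BP {V : Type} [DecidableEq V] (R B : V → V → Prop) : V → V → Finset V → ℕ → Prop
  | single (a : V) : BP R B a a {a} 0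
  | good {a b c : V} {S : Finset V} {k : ℕ} :
      R a b → BP R B b c S k → a ∉ S → BP R B a c (insert a S) k
  | bad {a b c : V} {S : Finset V} {k : ℕ} :
      B a b → BP R B b c S k → a ∉ S → BP R B a c (insert a S) (k + 1)

section paths
variable {V : Type} [DecidableEq V] {R B : V → V → Prop}

lemma Pth_s14.left_mem {a b : V} {S : Finset V} (h : Pth_s14 R a b S) : a ∈ S := by
  cases h <;> simp

lemma Pth_s14.right_mem {a b : V} {S : Finset V} (h : Pth_s14 R a b S) : b ∈ S := by
  induction h <;> simp_all

lemma Pth_s14.append {a b c d : V} {S T : Finset V} (h : Pth_s14 R a b S) (hbc : R b c)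
    (h' : Pth_s14 R c d T) (hd : Disjoint S T) : Pth_s14 R a d (S ∪ T) := by
  induction h with
  | single a =>
    rw [← Finset.insert_eq]
    exact .cons hbc h' (by simpa using hd)
  | cons r p ha ih =>
    rw [Finset.disjoint_insert_left] at hd
    rw [Finset.insert_union]
    exact .cons r (ih hbc hd.2) (by simp [ha, hd.1])

lemma Pth_s14.symm (hs : ∀ x y, R x y → R y x) {a b : V} {S : Finset V} (h : Pth_s14 R a b S) :
    Pth_s14 R b a S := by
  induction h with
  | single a => exact .single a
  | cons r p ha ih =>
    rw [Finset.insert_eq, Finset.union_comm]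
    exact ih.append (hs _ _ r) (.single _) (by simpa using ha)

lemma Pth_s14.mono {R' : V → V → Prop} (hs : ∀ x y, R x y → R' x y) {a b : V} {S : Finset V}
    (h : Pth_s14 R a b S) : Pth_s14 R' a b S := by
  induction h with
  | single a => exact .single a
  | cons r p ha ih => exact .cons (hs _ _ r) ih ha

/-- A path from any of its vertices to the end. -/
lemma Pth_s14.suffix {a b x : V} {S : Finset V} (h : Pth_s14 R a b S) (hx : x ∈ S) :
    ∃ T ⊆ S, Pth_s14 R x b T := by
  induction h with
  | single a => simp only [Finset.mem_singleton] at hx; subst hx; exact ⟨_, subset_rfl, .single _⟩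
  | cons r p ha ih =>
    rcases Finset.mem_insert.1 hx with rfl | hx
    · exact ⟨_, subset_rfl, .cons r p ha⟩
    · obtain ⟨T, hT, q⟩ := ih hx
      exact ⟨T, hT.trans (Finset.subset_insert _ _), q⟩

/-- Splitting a path just before one of its vertices. -/
lemma Pth_s14.split {a b x : V} {S : Finset V} (h : Pth_s14 R a b S) (hx : x ∈ S) :
    x = a ∨ ∃ y S₁ S₂, Pth_s14 R a y S₁ ∧ R y x ∧ Pth_s14 R x b S₂ ∧ Disjoint S₁ S₂ ∧ S = S₁ ∪ S₂ := by
  induction h with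
  | single a => left; simpa using hx
  | @cons a b c S r p ha ih =>
    rcases Finset.mem_insert.1 hx with rfl | hx
    · exact .inl rfl
    · right
      rcases ih hx with rfl | ⟨y, S₁, S₂, h1, h2, h3, h4, rfl⟩
      · exact ⟨a, {a}, S, .single a, r, p, by simpa using ha, by rw [Finset.insert_eq]⟩
      · simp only [Finset.mem_union, not_or] at ha
        exact ⟨y, insert a S₁, S₂, .cons r h1 ha.1, h2, h3, by simp [ha.2, h4],
          by rw [Finset.insert_union]⟩

lemma BP.left_mem {a b : V} {S : Finset V} {k : ℕ} (h : BP R B a b S k) : a ∈ S := by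
  cases h <;> simp

lemma BP.right_mem {a b : V} {S : Finset V} {k : ℕ} (h : BP R B a b S k) : b ∈ S := by
  induction h <;> simp_all

lemma BP.append {a b c d : V} {S T : Finset V} {k l : ℕ} (h : BP R B a b S k) (hbc : R b c)
    (h' : BP R B c d T l) (hd : Disjoint S T) : BP R B a d (S ∪ T) (k + l) := by
  induction h with
  | single a =>
    rw [← Finset.insert_eq, zero_add]
    exact .good hbc h' (by simpa using hd)
  | good r p ha ih =>
    rw [Finset.disjoint_insert_left] at hd
    rw [Finset.insert_union]
    exact .good r (ih hbc hd.2) (by simp [ha, hd.1])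
  | bad r p ha ih =>
    rw [Finset.disjoint_insert_left] at hd
    rw [Finset.insert_union, add_right_comm]
    exact .bad r (ih hbc hd.2) (by simp [ha, hd.1])

lemma BP.append_bad {a b c d : V} {S T : Finset V} {k l : ℕ} (h : BP R B a b S k) (hbc : B b c)
    (h' : BP R B c d T l) (hd : Disjoint S T) : BP R B a d (S ∪ T) (k + l + 1) := by
  induction h with
  | single a =>
    rw [← Finset.insert_eq, zero_add]
    exact .bad hbc h' (by simpa using hd)
  | good r p ha ih =>
    rw [Finset.disjoint_insert_left] at hd
    rw [Finset.insert_union]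
    exact .good r (ih hbc hd.2) (by simp [ha, hd.1])
  | bad r p ha ih =>
    rw [Finset.disjoint_insert_left] at hd
    rw [Finset.insert_union, add_right_comm _ 1 l]
    exact .bad r (ih hbc hd.2) (by simp [ha, hd.1])

lemma BP.symm (hs : ∀ x y, R x y → R y x) (hb : ∀ x y, B x y → B y x) {a b : V} {S : Finset V}
    {k : ℕ} (h : BP R B a b S k) : BP R B b a S k := by
  induction h with
  | single a => exact .single a
  | good r p ha ih =>
    rw [Finset.insert_eq, Finset.union_comm]
    exact ih.append (hs _ _ r) (.single _) (by simpa using ha)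
  | bad r p ha ih =>
    rw [Finset.insert_eq, Finset.union_comm]
    exact ih.append_bad (hb _ _ r) (.single _) (by simpa using ha)

lemma BP.toPth {a b : V} {S : Finset V} {k : ℕ} (h : BP R B a b S k) (hk : k = 0) :
    Pth_s14 R a b S := by
  induction h with
  | single a => exact .single a
  | good r p ha ih => exact .cons r (ih hk) ha
  | bad r p ha ih => omega

lemma Pth_s14.toBP {a b : V} {S : Finset V} (h : Pth_s14 (fun x y => R x y ∨ B x y) a b S) :
    ∃ k, BP R B a b S k := by
  induction h with
  | single a => exact ⟨0, .single a⟩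
  | cons r p ha ih =>
    obtain ⟨k, hk⟩ := ih
    rcases r with r | r
    · exact ⟨k, .good r hk ha⟩
    · exact ⟨k + 1, .bad r hk ha⟩

/-- A path with a bad edge can be split at a bad edge. -/
lemma BP.split_bad {a b : V} {S : Finset V} {k : ℕ} (h : BP R B a b S k) (hk : 0 < k) :
    ∃ x y S₁ S₂ k₁ k₂, BP R B a x S₁ k₁ ∧ B x y ∧ BP R B y b S₂ k₂ ∧ Disjoint S₁ S₂ ∧
      S = S₁ ∪ S₂ ∧ k = k₁ + k₂ + 1 := by
  induction h with
  | single a => omega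
  | @good a b c S k r p ha ih =>
    obtain ⟨x, y, S₁, S₂, k₁, k₂, h1, h2, h3, h4, rfl, h5⟩ := ih hk
    simp only [Finset.mem_union, not_or] at ha
    exact ⟨x, y, insert a S₁, S₂, k₁, k₂, .good r h1 ha.1, h2, h3, by simp [ha.2, h4],
      by rw [Finset.insert_union], h5⟩
  | @bad a b c S k r p ha ih =>
    exact ⟨a, b, {a}, S, 0, k, .single a, r, p, by simpa using ha, by rw [Finset.insert_eq],
      by omega⟩

/-- Crossing lemma. -/
lemma BP.cross (P Q : V → Prop) [DecidablePred P] [DecidablePred Q]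
    {a b : V} {S : Finset V} {k : ℕ} (h : BP R B a b S k) :
    (∃ x y S₁ S₂ k₁ k₂, BP R B a x S₁ k₁ ∧ BP R B y b S₂ k₂ ∧ Disjoint S₁ S₂ ∧
      S = S₁ ∪ S₂ ∧ k₁ + k₂ ≤ k ∧ Q x ∧ P y) ∨
    ((S.erase a).filter P).card + ((S.erase b).filter Q).card + 1 ≤ S.card := by
  have key : ∀ {a b c : V} {S : Finset V}, a ∉ S → b ∈ S → c ∈ S → ¬ (Q a ∧ P b) →
      ((S.erase b).filter P).card + ((S.erase c).filter Q).card + 1 ≤ S.card →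
      (((insert a S).erase a).filter P).card + (((insert a S).erase c).filter Q).card + 1
        ≤ (insert a S).card := by
    intro a b c S ha hb hc hn hle
    have hac : a ≠ c := fun h => ha (h ▸ hc)
    rw [Finset.card_insert_of_notMem ha, Finset.erase_insert ha,
      Finset.erase_insert_of_ne hac, Finset.filter_insert]
    have h1 : (S.filter P).card = ((S.erase b).filter P).card + if P b then 1 else 0 := by
      conv_lhs => rw [← Finset.insert_erase hb, Finset.filter_insert]
      split_ifs
      · rw [Finset.card_insert_of_notMem (by simp)]
      · rfl
    rw [h1]
    by_cases hQ : Q a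
    · have hP : ¬ P b := fun h => hn ⟨hQ, h⟩
      have := Finset.card_insert_le a ((S.erase c).filter Q)
      simp only [hQ, hP, if_true, if_false]
      omega
    · simp only [hQ, if_false]
      split_ifs <;> omega
  induction h with
  | single a => right; simp
  | @good a b c S k r p ha ih =>
    by_cases hn : Q a ∧ P b
    · exact .inl ⟨a, b, {a}, S, 0, k, .single a, p, by simpa using ha, by rw [Finset.insert_eq],
        by omega, hn.1, hn.2⟩
    · rcases ih with ⟨x, y, S₁, S₂, k₁, k₂, h1, h3, h4, rfl, h5, h6⟩ | ih
      · simp only [Finset.mem_union, not_or] at ha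
        exact .inl ⟨x, y, insert a S₁, S₂, k₁, k₂, .good r h1 ha.1, h3, by simp [ha.2, h4],
          by rw [Finset.insert_union], h5, h6⟩
      · exact .inr (key ha p.left_mem p.right_mem hn ih)
  | @bad a b c S k r p ha ih =>
    by_cases hn : Q a ∧ P b
    · exact .inl ⟨a, b, {a}, S, 0, k, .single a, p, by simpa using ha, by rw [Finset.insert_eq],
        by omega, hn.1, hn.2⟩
    · rcases ih with ⟨x, y, S₁, S₂, k₁, k₂, h1, h3, h4, rfl, h5, h6⟩ | ih
      · simp only [Finset.mem_union, not_or] at ha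
        exact .inl ⟨x, y, insert a S₁, S₂, k₁ + 1, k₂, .bad r h1 ha.1, h3, by simp [ha.2, h4],
          by rw [Finset.insert_union], by omega, h6⟩
      · exact .inr (key ha p.left_mem p.right_mem hn ih)

/-- `S` is the vertex set of an `R`-cycle. -/
def Cyc (R : V → V → Prop) (S : Finset V) : Prop :=
  ∃ a b, Pth_s14 R a b S ∧ R b a ∧ 3 ≤ S.card

lemma Cyc.rot {S : Finset V} (h : Cyc R S) {u : V} (hu : u ∈ S) :
    ∃ d, Pth_s14 R u d S ∧ R d u := by
  obtain ⟨a, b, p, hba, -⟩ := h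
  rcases p.split hu with rfl | ⟨y, S₁, S₂, h1, h2, h3, h4, rfl⟩
  · exact ⟨b, p, hba⟩
  · refine ⟨y, ?_, h2⟩
    rw [Finset.union_comm]
    exact h3.append hba h1 h4.symm

end paths

section closing
variable {V : Type} [Fintype V] [DecidableEq V] (G : SimpleGraph V) [DecidableRel G.Adj]

/-- heavy vertices -/
def Hv (x : V) : Prop := Fintype.card V ≤ 2 * G.degree x

/-- pairs of distinct heavy vertices -/
def HH (x y : V) : Prop := Hv G x ∧ Hv G y ∧ x ≠ y

/-- `o`-adjacency -/
def OA (x y : V) : Prop := G.Adj x y ∨ HH G x y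

variable {G}

lemma HH.symm' : ∀ x y, HH G x y → HH G y x := fun _ _ h => ⟨h.2.1, h.1, h.2.2.symm⟩
lemma OA.symm' : ∀ x y, OA G x y → OA G y x := fun _ _ h => h.imp (fun h => h.symm) (HH.symm' _ _)
lemma OA.symm {x y : V} (h : OA G x y) : OA G y x := OA.symm' _ _ h

lemma close_one {a b : V} {S : Finset V} {k : ℕ} (h : BP G.Adj (HH G) a b S k)
    (hab : HH G b a) (h3 : 3 ≤ S.card) :
    ∃ a' b' T k', BP G.Adj (HH G) a' b' T k' ∧ G.Adj b' a' ∧ S ⊆ T ∧ k' ≤ k := by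
  by_cases hw : ∃ w, w ∉ S ∧ G.Adj a w ∧ G.Adj b w
  · obtain ⟨w, hwS, haw, hbw⟩ := hw
    exact ⟨w, b, insert w S, k, .good haw.symm h hwS, hbw, Finset.subset_insert _ _, le_rfl⟩
  rcases h.cross (G.Adj a) (G.Adj b) with
    ⟨x, y, S₁, S₂, k₁, k₂, h1, h2, h4, rfl, h5, h6, h7⟩ | hc
  · refine ⟨y, a, S₂ ∪ S₁, k₂ + k₁, ?_, h7, by rw [Finset.union_comm], by omega⟩
    exact h2.append h6 (h1.symm (fun _ _ h => h.symm) HH.symm') h4.symm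
  · exfalso
    have e1 : G.degree a = ((S.erase a).filter (G.Adj a)).card
        + (Sᶜ.filter (G.Adj a)).card := by
      rw [← G.card_neighborFinset_eq_degree, ← Finset.card_union_of_disjoint]
      · congr 1; ext x; by_cases hx : x ∈ S <;> simp [hx]
        rintro h rfl; exact G.loopless.irrefl _ h
      · rw [Finset.disjoint_left]; intro x; simp; tauto
    have e2 : G.degree b = ((S.erase b).filter (G.Adj b)).card
        + (Sᶜ.filter (G.Adj b)).card := by
      rw [← G.card_neighborFinset_eq_degree, ← Finset.card_union_of_disjoint]
      · congr 1; ext x; by_cases hx : x ∈ S <;> simp [hx]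
        rintro h rfl; exact G.loopless.irrefl _ h
      · rw [Finset.disjoint_left]; intro x; simp; tauto
    have e3 : (Sᶜ.filter (G.Adj a)).card + (Sᶜ.filter (G.Adj b)).card ≤ Sᶜ.card := by
      rw [← Finset.card_union_of_disjoint]
      · apply Finset.card_le_card; intro x; simp; tauto
      · rw [Finset.disjoint_left]; intro x; simp
        intro h1 h2 _ h3; exact hw ⟨x, h1, h2, h3⟩
    have e4 := Finset.card_add_card_compl S
    obtain ⟨g1, g2, -⟩ := hab
    unfold Hv at g1 g2
    omega

lemma close_all (k : ℕ) : ∀ {a b : V} {S : Finset V}, BP G.Adj (HH G) a b S k → G.Adj b a →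
    3 ≤ S.card → ∃ T, Cyc G.Adj T ∧ S ⊆ T := by
  induction k using Nat.strong_induction_on with
  | _ k ih =>
    intro a b S h hba h3
    rcases Nat.eq_zero_or_pos k with hk | hk
    · exact ⟨S, ⟨a, b, h.toPth hk, hba, h3⟩, subset_rfl⟩
    · obtain ⟨x, y, S₁, S₂, k₁, k₂, h1, h2, h4, h5, rfl, h6⟩ := h.split_bad hk
      have := h4.append hba h1 h5.symm
      rw [Finset.union_comm] at this
      obtain ⟨a', b', T, k', g1, g2, g3, g4⟩ := close_one this h2 h3
      obtain ⟨T', g5, g6⟩ := ih k' (by omega) g1 g2 (h3.trans (Finset.card_le_card g3))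
      exact ⟨T', g5, g3.trans g6⟩

lemma Cyc.close {S : Finset V} (h : Cyc (OA G) S) : ∃ T, Cyc G.Adj T ∧ S ⊆ T := by
  obtain ⟨a, b, p, hba, h3⟩ := h
  obtain ⟨k, hk⟩ := Pth_s14.toBP (R := G.Adj) (B := HH G) p
  rcases hba with hba | hba
  · exact close_all k hk hba h3
  · obtain ⟨a', b', T, k', g1, g2, g3, g4⟩ := close_one hk hba h3
    obtain ⟨T', g5, g6⟩ := close_all k' g1 g2 (h3.trans (Finset.card_le_card g3))
    exact ⟨T', g5, g3.trans g6⟩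

end closing

section conf
variable {V : Type} [Fintype V] [DecidableEq V] {G : SimpleGraph V} [DecidableRel G.Adj]

/-- `S` cannot be enlarged to the vertex set of a larger `o`-cycle. -/
def MaxO (G : SimpleGraph V) [DecidableRel G.Adj] (S : Finset V) : Prop :=
  3 ≤ S.card ∧ ∀ T, Cyc (OA G) T → S ⊆ T → T ⊆ S

/-- Two vertices and two paths covering `S`; the intended cyclic order is
`u, a … b, v, c … d`. -/
structure Conf (G : SimpleGraph V) [DecidableRel G.Adj] (S : Finset V) (u v a b c d : V)
    (S₁ S₂ : Finset V) : Prop where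
  p₁ : Pth_s14 (OA G) a b S₁
  p₂ : Pth_s14 (OA G) c d S₂
  uv : u ≠ v
  u₁ : u ∉ S₁
  u₂ : u ∉ S₂
  v₁ : v ∉ S₁
  v₂ : v ∉ S₂
  dis : Disjoint S₁ S₂
  eq : S = insert u (insert v (S₁ ∪ S₂))

lemma Conf.swap {S S₁ S₂ : Finset V} {u v a b c d : V} (h : Conf G S u v a b c d S₁ S₂) :
    Conf G S v u c d a b S₂ S₁ :=
  ⟨h.p₂, h.p₁, h.uv.symm, h.v₂, h.v₁, h.u₂, h.u₁, h.dis.symm, by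
    rw [h.eq, Finset.insert_comm, Finset.union_comm]⟩

lemma Conf.rev {S S₁ S₂ : Finset V} {u v a b c d : V} (h : Conf G S u v a b c d S₁ S₂) :
    Conf G S u v d c b a S₂ S₁ :=
  ⟨h.p₂.symm OA.symm', h.p₁.symm OA.symm', h.uv, h.u₂, h.u₁, h.v₂, h.v₁, h.dis.symm, by
    rw [h.eq, Finset.union_comm]⟩

lemma MaxO.absurd {S T : Finset V} (hm : MaxO G S) {a b x : V} (p : Pth_s14 (OA G) a b T)
    (hba : OA G b a) (hS : S ⊆ T) (hx : x ∈ T) (hxS : x ∉ S) : False :=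
  hxS (hm.2 T ⟨a, b, p, hba, hm.1.trans (Finset.card_le_card hS)⟩ hS hx)

/-- No outside path can be inserted between `u` and `a`. -/
lemma Conf.ins {S S₁ S₂ T : Finset V} {u v a b c d p q : V}
    (h : Conf G S u v a b c d S₁ S₂) (hm : MaxO G S)
    (hbv : OA G b v) (hvc : OA G v c) (hdu : OA G d u)
    (hT : Pth_s14 (OA G) p q T) (hTS : Disjoint T S) (hup : OA G u p) : ¬ OA G q a := by
  intro hqa
  obtain ⟨p₁, p₂, uv, u₁, u₂, v₁, v₂, dis, rfl⟩ := h
  have hpT := hT.left_mem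
  have hpS := Finset.disjoint_left.1 hTS hpT
  simp only [Finset.disjoint_insert_right, Finset.disjoint_union_right] at hTS
  obtain ⟨t1, t2, t3, t4⟩ := hTS
  have c1 := (Pth_s14.single u).append hup hT (by simpa using t1)
  have c2 := c1.append hqa p₁ (by simp [u₁, t3])
  have c3 := c2.append hbv (.single v) (by simp [uv.symm, t2, v₁])
  have c4 := c3.append hvc p₂ (by simp [u₂, v₂, t4, dis])
  refine hm.absurd c4 hdu ?_ (x := p) ?_ hpS
  · intro x; simp; tauto
  · simp [hpT]

/-- The ear crossing: `a` and `c` are not `o`-adjacent. -/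
lemma Conf.cross {S S₁ S₂ T : Finset V} {u v a b c d p q : V}
    (h : Conf G S u v a b c d S₁ S₂) (hm : MaxO G S)
    (hbv : OA G b v) (hdu : OA G d u)
    (hT : Pth_s14 (OA G) p q T) (hTS : Disjoint T S) (hup : OA G u p) (hqv : OA G q v) :
    ¬ OA G a c := by
  intro hac
  obtain ⟨p₁, p₂, uv, u₁, u₂, v₁, v₂, dis, rfl⟩ := h
  have hpT := hT.left_mem
  have hpS := Finset.disjoint_left.1 hTS hpT
  simp only [Finset.disjoint_insert_right, Finset.disjoint_union_right] at hTS
  obtain ⟨t1, t2, t3, t4⟩ := hTS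
  have c1 := (Pth_s14.single u).append hup hT (by simpa using t1)
  have c2 := c1.append hqv (.single v) (by simp [uv.symm, t2])
  have c3 := c2.append hbv.symm (p₁.symm OA.symm') (by simp [u₁, v₁, t3])
  have c4 := c3.append hac p₂ (by simp [u₂, v₂, t4, dis])
  refine hm.absurd c4 hdu ?_ (x := p) ?_ hpS
  · intro x; simp; tauto
  · simp [hpT]

/-- With a bypass of `v`, `a` and `v` are not `o`-adjacent. -/
lemma Conf.bypass {S S₁ S₂ T : Finset V} {u v a b c d p q : V}
    (h : Conf G S u v a b c d S₁ S₂) (hm : MaxO G S)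
    (hbc : OA G b c) (hdu : OA G d u)
    (hT : Pth_s14 (OA G) p q T) (hTS : Disjoint T S) (hup : OA G u p) (hqv : OA G q v) :
    ¬ OA G a v := by
  intro hav
  obtain ⟨p₁, p₂, uv, u₁, u₂, v₁, v₂, dis, rfl⟩ := h
  have hpT := hT.left_mem
  have hpS := Finset.disjoint_left.1 hTS hpT
  simp only [Finset.disjoint_insert_right, Finset.disjoint_union_right] at hTS
  obtain ⟨t1, t2, t3, t4⟩ := hTS
  have c1 := (Pth_s14.single u).append hup hT (by simpa using t1)
  have c2 := c1.append hqv (.single v) (by simp [uv.symm, t2])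
  have c3 := c2.append hav.symm p₁ (by simp [u₁, v₁, t3])
  have c4 := c3.append hbc p₂ (by simp [u₂, v₂, t4, dis])
  refine hm.absurd c4 hdu ?_ (x := p) ?_ hpS
  · intro x; simp; tauto
  · simp [hpT]

/-- Usable form of the claw condition. -/
def ClawC (G : SimpleGraph V) [DecidableRel G.Adj] : Prop :=
  ∀ t x y w, G.Adj t x → G.Adj t y → G.Adj t w → x ≠ y → x ≠ w → y ≠ w →
    ¬ G.Adj x y → ¬ G.Adj x w → ¬ G.Adj y w → (Hv G x ∨ Hv G w) ∧ (Hv G y ∨ Hv G w)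

/-- Usable form of the `Z₂` condition. -/
def ZC (G : SimpleGraph V) [DecidableRel G.Adj] : Prop :=
  ∀ x y t p q, G.Adj x y → G.Adj x t → G.Adj y t → G.Adj t p → G.Adj p q → t ≠ q →
    ¬ G.Adj x p → ¬ G.Adj x q → ¬ G.Adj y p → ¬ G.Adj y q → ¬ G.Adj t q →
    (Hv G x ∨ Hv G p) ∧ (Hv G y ∨ Hv G p)

/-- Moving along the cycle until a heavy vertex is found. -/
lemma Conf.process (hZ : ZC G) {S : Finset V} (hm : MaxO G S) {z u v : V} (hzS : z ∉ S)
    (hzH : ¬ Hv G z) (huz : G.Adj u z) (hvz : G.Adj v z) (huv : G.Adj u v) {b c : V}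
    (hbv : OA G b v) (hvc : OA G v c) (hbc : OA G b c) (n : ℕ) :
    ∀ {a d S₁ S₂}, S₁.card = n → Conf G S u v a b c d S₁ S₂ → G.Adj u a → OA G d u → OA G d a →
    ∃ a' d' S₁' S₂', Conf G S u v a' b c d' S₁' S₂' ∧ G.Adj u a' ∧ OA G d' u ∧ OA G d' a' ∧
      Hv G a' := by
  have hT : Pth_s14 (OA G) z z {z} := .single z
  have hTS : Disjoint {z} S := by simpa using hzS
  induction n with
  | zero =>
    intro a d S₁ S₂ hn h
    rw [Finset.card_eq_zero] at hn
    have := h.p₁.left_mem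
    simp [hn] at this
  | succ n ih =>
    intro a d S₁ S₂ hn h hua hdu hda
    by_cases haH : Hv G a
    · exact ⟨a, d, S₁, S₂, h, hua, hdu, hda, haH⟩
    have hbu : ¬ OA G b u :=
      h.swap.rev.bypass hm hda.symm hvc.symm hT hTS (.inl hvz) (.inl huz.symm)
    have hza := h.ins hm hbv hvc hdu hT hTS (.inl huz)
    have hav := h.bypass hm hbc hdu hT hTS (.inl huz) (.inl hvz.symm)
    have h' := h
    obtain ⟨p₁, p₂, uv, u₁, u₂, v₁, v₂, dis, e⟩ := h
    cases p₁ with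
    | single => exact absurd (.inl hua.symm) hbu
    | @cons _ a₁ _ S₁ r p ha =>
      rw [Finset.mem_insert, not_or] at u₁ v₁
      rw [Finset.disjoint_insert_left] at dis
      rw [Finset.card_insert_of_notMem ha] at hn
      have hc : Conf G S u v a₁ b c a S₁ (S₂ ∪ {a}) := by
        refine ⟨p, p₂.append hda (.single a) (by simpa using dis.1), uv, u₁.2, ?_, v₁.2, ?_, ?_, ?_⟩
        · simp [u₁.1, u₂]
        · simp [v₁.1, v₂]
        · simp [dis.2, ha]
        · rw [e]; ext x; simp; try tauto
      have hau : OA G a u := .inl hua.symm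
      by_cases hua₁ : G.Adj u a₁
      · exact ih (by omega) hc hua₁ hau r
      · exfalso
        have haa : G.Adj a a₁ := r.resolve_right (fun h => haH h.1)
        have hza₁ := hc.ins hm hbv hvc hau hT hTS (.inl huz)
        have hav₁ := hc.bypass hm hbc hau hT hTS (.inl huz) (.inl hvz.symm)
        have := hZ z v u a a₁ hvz.symm huz.symm huv.symm hua haa
          (fun h => u₁.2 (h ▸ p.left_mem)) (fun h => hza (.inl h)) (fun h => hza₁ (.inl h))
          (fun h => hav (.inl h.symm)) (fun h => hav₁ (.inl h.symm)) hua₁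
        tauto

/-- The bypass at `u`. -/
lemma Conf.claw (hC : ClawC G) {S S₁ S₂ : Finset V} (hm : MaxO G S)
    (hH : ∀ x, Hv G x → x ∈ S) {u v a b c d z : V}
    (h : Conf G S u v a b c d S₁ S₂) (hua : G.Adj u a) (hbv : OA G b v) (hvc : OA G v c)
    (hdu : G.Adj d u) (hzS : z ∉ S) (huz : G.Adj u z) :
    G.Adj d a ∨ (Hv G a ∧ Hv G d) := by
  by_cases hda : G.Adj d a
  · exact .inl hda
  right
  have hT : Pth_s14 (OA G) z z {z} := .single z
  have hTS : Disjoint {z} S := by simpa using hzS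
  have hza := h.ins hm hbv hvc (.inl hdu) hT hTS (.inl huz)
  have hzd := h.rev.ins hm hvc.symm hbv.symm (.inl hua.symm) hT hTS (.inl huz)
  have ha : a ∈ S := by rw [h.eq]; simp [h.p₁.left_mem]
  have hd : d ∈ S := by rw [h.eq]; simp [h.p₂.right_mem]
  have had : a ≠ d := fun e => Finset.disjoint_left.1 h.dis h.p₁.left_mem (e ▸ h.p₂.right_mem)
  have := hC u a d z hua hdu.symm huz had (fun e => hzS (e ▸ ha)) (fun e => hzS (e ▸ hd))
    (fun h => hda h.symm) (fun h => hza (.inl h.symm)) (fun h => hzd (.inl h.symm))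
  have hz : ¬ Hv G z := fun h => hzS (hH z h)
  tauto

/-- `a` is heavy if the ear continues suitably. -/
lemma Conf.heavy (hC : ClawC G) (hZ : ZC G) {S S₁ S₂ : Finset V} (hm : MaxO G S)
    (hH : ∀ x, Hv G x → x ∈ S) {u v a b c d z q : V}
    (h : Conf G S u v a b c d S₁ S₂) (hua : G.Adj u a) (hbv : OA G b v) (hvc : OA G v c)
    (hdu : G.Adj d u) (hzS : z ∉ S) (huz : G.Adj u z) (hzq : G.Adj z q) (huq : ¬ G.Adj u q)
    (hne : u ≠ q) (hqa : ¬ G.Adj a q) (hqd : ¬ G.Adj d q) : Hv G a := by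
  rcases h.claw hC hm hH hua hbv hvc hdu hzS huz with hda | ha
  · have hT : Pth_s14 (OA G) z z {z} := .single z
    have hTS : Disjoint {z} S := by simpa using hzS
    have hza := h.ins hm hbv hvc (.inl hdu) hT hTS (.inl huz)
    have hzd := h.rev.ins hm hvc.symm hbv.symm (.inl hua.symm) hT hTS (.inl huz)
    have := hZ d a u z q hda hdu hua.symm huz hzq hne (fun h => hzd (.inl h.symm)) hqd
      (fun h => hza (.inl h.symm)) hqa huq
    have hz : ¬ Hv G z := fun h => hzS (hH z h)
    tauto
  · exact ha.1

/-- An ear of the set `S`. -/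
def Ear (G : SimpleGraph V) (S : Finset V) (u v p q : V) (T : Finset V) : Prop :=
  u ∈ S ∧ v ∈ S ∧ u ≠ v ∧ Pth_s14 G.Adj p q T ∧ Disjoint T S ∧ G.Adj u p ∧ G.Adj q v

lemma Ear.symm {S T : Finset V} {u v p q : V} (h : Ear G S u v p q T) : Ear G S v u q p T :=
  ⟨h.2.1, h.1, h.2.2.1.symm, h.2.2.2.1.symm (fun _ _ h => h.symm), h.2.2.2.2.1,
    h.2.2.2.2.2.2.symm, h.2.2.2.2.2.1.symm⟩

lemma pO {a b : V} {S : Finset V} (h : Pth_s14 G.Adj a b S) : Pth_s14 (OA G) a b S :=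
  h.mono (fun _ _ h => .inl h)

/-- A long minimal ear makes the successor of its end heavy. -/
lemma Conf.heavy_long (hC : ClawC G) (hZ : ZC G) {S S₁ S₂ T : Finset V} (hm : MaxO G S)
    (hH : ∀ x, Hv G x → x ∈ S) {u v a b c d p q : V}
    (h : Conf G S u v a b c d S₁ S₂) (hua : G.Adj u a) (hbv : OA G b v) (hvc : OA G v c)
    (hdu : G.Adj d u) (he : Ear G S u v p q T)
    (hmin : ∀ u v p q T', Ear G S u v p q T' → T.card ≤ T'.card) (hpq : p ≠ q) : Hv G a := by
  obtain ⟨huS, hvS, huv, hT, hTS, hup, hqv⟩ := he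
  cases hT with
  | single => exact absurd rfl hpq
  | @cons _ p₁ _ T r hT hp =>
    rw [Finset.disjoint_insert_left] at hTS
    have hp₁ : p₁ ∉ S := Finset.disjoint_left.1 hTS.2 hT.left_mem
    have hP : Pth_s14 (OA G) p p₁ (insert p {p₁}) := .cons (.inl r) (.single _) (by simpa using r.ne)
    have hPS : Disjoint (insert p {p₁}) S := by simp [hTS.1, hp₁]
    have hza := h.ins hm hbv hvc (.inl hdu) hP hPS (.inl hup)
    have hzd := h.rev.ins hm hvc.symm hbv.symm (.inl hua.symm) hP hPS (.inl hup)
    refine h.heavy hC hZ hm hH hua hbv hvc hdu hTS.1 hup r ?_ (fun e => hp₁ (e ▸ huS))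
      (fun h => hza (.inl h.symm)) (fun h => hzd (.inl h.symm))
    intro hup₁
    have := hmin u v p₁ q T ⟨huS, hvS, huv, hT, hTS.2, hup₁, hqv⟩
    rw [Finset.card_insert_of_notMem hp] at this
    omega

/-- The main contradiction. -/
lemma main_contra (hC : ClawC G) (hZ : ZC G) {S T : Finset V} (hcyc : Cyc G.Adj S)
    (hm : MaxO G S) (hH : ∀ x, Hv G x → x ∈ S) {u v p q : V} (he : Ear G S u v p q T)
    (hmin : ∀ u v p q T', Ear G S u v p q T' → T.card ≤ T'.card) : False := by
  have he' := he
  obtain ⟨huS, hvS, huv, hT, hTS, hup, hqv⟩ := he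
  have hTO := pO hT
  have hpT := hT.left_mem
  have hpS := Finset.disjoint_left.1 hTS hpT
  have hqS := Finset.disjoint_left.1 hTS hT.right_mem
  -- decompose the cycle
  obtain ⟨a, b, c, d, S₁, S₂, h, hua, hbv, hvc, hdu⟩ : ∃ a b c d S₁ S₂,
      Conf G S u v a b c d S₁ S₂ ∧ G.Adj u a ∧ G.Adj b v ∧ G.Adj v c ∧ G.Adj d u := by
    have h3 := hm.1
    obtain ⟨d, hp, hdu⟩ := hcyc.rot huS
    cases hp with
    | single => simp at h3
    | @cons _ a _ S' hua hp huS' =>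
      have hvS' : v ∈ S' := by simpa [huv.symm] using hvS
      rw [Finset.disjoint_insert_right] at hTS
      rcases hp.split hvS' with rfl | ⟨b, S₁, S₂, h1, hbv, h2, h4, rfl⟩
      · exfalso
        have c1 := (Pth_s14.single u).append (.inl hup) hTO (by simpa using hTS.1)
        have c2 := c1.append (.inl hqv) (pO hp) (by simp [huS', hTS.2])
        refine hm.absurd c2 (.inl hdu) ?_ (x := p) (by simp [hpT]) hpS
        intro x; simp; tauto
      · simp only [Finset.mem_union, not_or] at huS'
        cases h2 with
        | single =>
          exfalso
          simp only [Finset.disjoint_union_right] at hTS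
          have c1 := (pO h1).append (.inl hbv) (.single _) h4
          have c2 := c1.append (.inl hqv.symm) (hTO.symm OA.symm')
            (by simp only [Finset.disjoint_union_left]; exact ⟨hTS.2.1.symm, hTS.2.2.symm⟩)
          have c3 := c2.append (.inl hup.symm) (.single u) (by simp [hTS.1, huS', huv])
          refine hm.absurd c3 (.inl hua) ?_ (x := p) (by simp [hpT]) hpS
          intro x; simp; tauto
        | @cons _ c _ S₂ hvc h2 hv =>
          simp only [Finset.disjoint_insert_right] at h4
          simp only [Finset.mem_insert, not_or] at huS'
          refine ⟨a, b, c, d, S₁, S₂, ⟨pO h1, pO h2, huv, huS'.1, huS'.2.2, h4.1, hv, h4.2, ?_⟩,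
            hua, hbv, hvc, hdu⟩
          ext x; simp; try tauto
  have hac : ¬ OA G a c := h.cross hm (.inl hbv) (.inl hdu) hTO hTS (.inl hup) (.inl hqv)
  have hne : a ≠ c := fun e => Finset.disjoint_left.1 h.dis h.p₁.left_mem (e ▸ h.p₂.left_mem)
  by_cases hpq : p = q
  · subst hpq
    have hbyu : OA G d a := (h.claw hC hm hH hua (.inl hbv) (.inl hvc) hdu hpS hup).imp id
      (fun g => ⟨g.2, g.1, fun e =>
        Finset.disjoint_left.1 h.dis h.p₁.left_mem (e ▸ h.p₂.right_mem)⟩)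
    have hbyv : OA G b c :=
      (h.swap.claw hC hm hH hvc (.inl hdu) (.inl hua) hbv hpS hqv.symm).imp id
      (fun g => ⟨g.2, g.1, fun e =>
        Finset.disjoint_left.1 h.dis h.p₁.right_mem (e ▸ h.p₂.left_mem)⟩)
    by_cases huvA : G.Adj u v
    · have hpH : ¬ Hv G p := fun g => hpS (hH p g)
      obtain ⟨a', d', S₁', S₂', h', hua', hdu', hda', ha'⟩ :=
        h.process hZ hm hpS hpH hup hqv.symm huvA (.inl hbv) (.inl hvc) hbyv _ rfl hua
          (.inl hdu) hbyu
      obtain ⟨c', b', S₂'', S₁'', h'', hvc', hbv', hbc', hc'⟩ :=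
        h'.swap.process hZ hm hpS hpH hqv.symm hup huvA.symm hdu' (.inl hua') hda' _ rfl hvc
          (.inl hbv) hbyv
      have := h''.cross hm hdu' hbv' (hTO.symm OA.symm') hTS (.inl hqv.symm) (.inl hup.symm)
      exact this (.inr ⟨hc', ha', fun e =>
        Finset.disjoint_left.1 h''.dis h''.p₁.left_mem (e ▸ h''.p₂.left_mem)⟩)
    · refine hac (.inr ⟨?_, ?_, hne⟩)
      · refine h.heavy hC hZ hm hH hua (.inl hbv) (.inl hvc) hdu hpS hup hqv huvA huv ?_ ?_
        · exact fun g => h.bypass hm hbyv (.inl hdu) hTO hTS (.inl hup) (.inl hqv) (.inl g)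
        · exact fun g => h.rev.bypass hm hbyv.symm (.inl hua.symm) hTO hTS (.inl hup) (.inl hqv)
            (.inl g)
      · refine h.swap.heavy hC hZ hm hH hvc (.inl hdu) (.inl hua) hbv hpS hqv.symm hup.symm
          (fun g => huvA g.symm) huv.symm ?_ ?_
        · exact fun g => h.swap.bypass hm hbyu (.inl hbv) (hTO.symm OA.symm') hTS (.inl hqv.symm)
            (.inl hup.symm) (.inl g)
        · exact fun g => h.swap.rev.bypass hm hbyu.symm (.inl hvc.symm) (hTO.symm OA.symm') hTS
            (.inl hqv.symm) (.inl hup.symm) (.inl g)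
  · refine hac (.inr ⟨?_, ?_, hne⟩)
    · exact h.heavy_long hC hZ hm hH hua (.inl hbv) (.inl hvc) hdu he' hmin hpq
    · exact h.swap.heavy_long hC hZ hm hH hvc (.inl hdu) (.inl hua) hbv he'.symm hmin
        (Ne.symm hpq)

end conf

section final
variable {V : Type} [Fintype V] [DecidableEq V] {G : SimpleGraph V} [DecidableRel G.Adj]

lemma dist_two {W : Type} (R : SimpleGraph W) {a b c : W} (h1 : R.Adj a b) (h2 : R.Adj b c)
    (h3 : a ≠ c) (h4 : ¬ R.Adj a c) : R.dist a c = 2 := by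
  have hle : R.dist a c ≤ 2 := SimpleGraph.dist_le (.cons h1 (.cons h2 .nil))
  have hr : R.Reachable a c := ⟨.cons h1 (.cons h2 .nil)⟩
  have h0 : R.dist a c ≠ 0 := fun h => h3 (hr.dist_eq_zero_iff.1 h)
  have h1' : R.dist a c ≠ 1 := fun h => h4 (SimpleGraph.dist_eq_one_iff_adj.1 h)
  omega

lemma hv_of_max {x y : V} (h : Fintype.card V ≤ 2 * max (G.degree x) (G.degree y)) :
    Hv G x ∨ Hv G y := by
  unfold Hv
  rcases le_total (G.degree x) (G.degree y) with h' | h'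
  · rw [max_eq_right h'] at h; exact .inr h
  · rw [max_eq_left h'] at h; exact .inl h

lemma clawC_of (h : FHeavy G claw) : ClawC G := by
  intro t x y w tx ty tw xy xw yw nxy nxw nyw
  have nyx : ¬ G.Adj y x := fun h => nxy h.symm
  have nwx : ¬ G.Adj w x := fun h => nxw h.symm
  have nwy : ¬ G.Adj w y := fun h => nyw h.symm
  let f : claw ↪g G :=
    { toFun := ![t, x, y, w]
      inj' := by
        intro i j
        fin_cases i <;> fin_cases j <;>
          simp [xy, xw, yw, xy.symm, xw.symm, yw.symm, tx.ne, ty.ne, tw.ne, tx.ne', ty.ne', tw.ne']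
      map_rel_iff' := by
        intro i j
        change G.Adj (![t, x, y, w] i) (![t, x, y, w] j) ↔ _
        fin_cases i <;> fin_cases j <;>
          simp [claw, tx, ty, tw, tx.symm, ty.symm, tw.symm, nxy, nxw, nyw, nyx, nwx, nwy] }
  have hd : ∀ i j : Fin 4, i ≠ 0 → j ≠ 0 → i ≠ j → claw.dist i j = 2 := by
    intro i j hi hj hij
    apply dist_two claw (b := 0) <;> simp [claw, hi, hj, hij, Ne.symm hj]
  exact ⟨hv_of_max (h f 1 3 (hd _ _ (by decide) (by decide) (by decide))),
    hv_of_max (h f 2 3 (hd _ _ (by decide) (by decide) (by decide)))⟩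

lemma zC_of (h : FHeavy G (Zgraph 2)) : ZC G := by
  intro x y t p q xy xt yt tp pq tq nxp nxq nyp nyq ntq
  have nyx : ¬ G.Adj p x := fun h => nxp h.symm
  have nqx : ¬ G.Adj q x := fun h => nxq h.symm
  have npy : ¬ G.Adj p y := fun h => nyp h.symm
  have nqy : ¬ G.Adj q y := fun h => nyq h.symm
  have nqt : ¬ G.Adj q t := fun h => ntq h.symm
  have xp : x ≠ p := by rintro rfl; exact nxq pq
  have xq : x ≠ q := by rintro rfl; exact nxp pq.symm
  have yp : y ≠ p := by rintro rfl; exact nyq pq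
  have yq : y ≠ q := by rintro rfl; exact nyp pq.symm
  let f : Zgraph 2 ↪g G :=
    { toFun := ![x, y, t, p, q]
      inj' := by
        intro i j
        fin_cases i <;> fin_cases j <;>
          simp [xy.ne, xt.ne, yt.ne, tp.ne, pq.ne, xy.ne', xt.ne', yt.ne', tp.ne', pq.ne', tq, xp,
            xq, yp, yq, tq.symm, xp.symm, xq.symm, yp.symm, yq.symm]
      map_rel_iff' := by
        intro i j
        change G.Adj (![x, y, t, p, q] i) (![x, y, t, p, q] j) ↔ _
        fin_cases i <;> fin_cases j <;>
          simp [Zgraph, xy, xt, yt, tp, pq, xy.symm, xt.symm, yt.symm, tp.symm, pq.symm,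
            nxp, nxq, nyp, nyq, ntq, nyx, nqx, npy, nqy, nqt] }
  refine ⟨hv_of_max (h f 0 3 ?_), hv_of_max (h f 1 3 ?_)⟩
  · apply dist_two _ (b := 2) <;> simp [Zgraph]
  · apply dist_two _ (b := 2) <;> simp [Zgraph]

/-- From a walk in an induced subgraph to a path leading to the set `S`. -/
lemma reach_set (s : Set V) (S : Finset V) {a b : s} (w : (G.induce s).Walk a b)
    (ha : (a : V) ∉ S) (hb : (b : V) ∈ S) :
    ∃ c v T, Pth_s14 G.Adj a c T ∧ Disjoint T S ∧ (∀ x ∈ T, x ∈ s) ∧ G.Adj c v ∧ v ∈ S ∧ v ∈ s := by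
  induction w with
  | nil => exact absurd hb ha
  | @cons a a' b r w ih =>
    by_cases ha' : (a' : V) ∈ S
    · exact ⟨a, a', {(a : V)}, .single _, by simpa using ha, by simp, r, ha', a'.2⟩
    · obtain ⟨c, v, T, h1, h2, h3, h4⟩ := ih ha' hb
      by_cases haT : (a : V) ∈ T
      · obtain ⟨T', hT', p⟩ := h1.suffix haT
        exact ⟨c, v, T', p, Finset.disjoint_of_subset_left hT' h2, fun x hx => h3 x (hT' hx), h4⟩
      · refine ⟨c, v, insert (a : V) T, .cons r h1 haT, by simp [ha, h2], ?_, h4⟩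
        intro x hx
        rcases Finset.mem_insert.1 hx with rfl | hx
        · exact a.2
        · exact h3 x hx

lemma TwoConnected.reach (h2 : TwoConnected G) (S : Finset V) {w a b : V} (ha : a ∉ S)
    (hb : b ∈ S) (haw : a ≠ w) (hbw : b ≠ w) :
    ∃ c v T, Pth_s14 G.Adj a c T ∧ Disjoint T S ∧ w ∉ T ∧ G.Adj c v ∧ v ∈ S ∧ v ≠ w := by
  obtain ⟨p⟩ := (h2.2 w).preconnected ⟨a, haw⟩ ⟨b, hbw⟩
  obtain ⟨c, v, T, h1, h2, h3, h4, h5, h6⟩ := reach_set _ S p ha hb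
  exact ⟨c, v, T, h1, h2, fun h => h3 w h rfl, h4, h5, h6⟩

lemma TwoConnected.exists_ear (h2 : TwoConnected G) {S : Finset V} (h3 : 3 ≤ S.card) {x : V}
    (hx : x ∉ S) : ∃ u v p q T, Ear G S u v p q T := by
  have other : ∀ w, ∃ s ∈ S, s ≠ w := fun w =>
    Finset.exists_mem_ne (by omega) w
  obtain ⟨w, hw⟩ : S.Nonempty := Finset.card_pos.1 (by omega)
  obtain ⟨s, hs, hsw⟩ := other w
  obtain ⟨p, u, T, h1, hT, -, hpu, hu, -⟩ :=
    h2.reach S hx hs (fun e => hx (e ▸ hw)) hsw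
  have hp : p ∉ S := Finset.disjoint_left.1 hT h1.right_mem
  obtain ⟨s', hs', hs'u⟩ := other u
  obtain ⟨q, v, T', h1', hT', -, hqv, hv, hvu⟩ :=
    h2.reach S hp hs' (fun e => hp (e ▸ hu)) hs'u
  exact ⟨u, v, p, q, T', hu, hv, hvu.symm, h1', hT', hpu.symm, hqv⟩

/-- every vertex lies on a cycle -/
lemma TwoConnected.cyc_mem (h2 : TwoConnected G) (x : V) : ∃ S, Cyc G.Adj S ∧ x ∈ S := by
  have hc := h2.1
  -- `x` has a neighbour different from any given `w ≠ x`
  have nb : ∀ w, w ≠ x → ∃ y, G.Adj x y ∧ y ≠ w := by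
    intro w hw
    obtain ⟨s, hs', hs⟩ : ∃ s ∈ (Finset.univ.erase x), s ≠ w := by
      apply Finset.exists_mem_ne
      rw [Finset.card_erase_of_mem (Finset.mem_univ _), Finset.card_univ]; omega
    have hsx : s ≠ x := by simpa using hs'
    obtain ⟨c, v, T, h1, hT, hwT, hcv, hv, hvw⟩ :=
      h2.reach {x} (a := s) (b := x) (w := w) (by simpa using hsx) (by simp) hs hw.symm
    rw [Finset.mem_singleton] at hv
    subst hv
    exact ⟨c, hcv.symm, fun e => hwT (e ▸ h1.right_mem)⟩
  obtain ⟨w, hw⟩ : ∃ w, w ≠ x := by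
    haveI : Nontrivial V := Fintype.one_lt_card_iff_nontrivial.1 (by omega)
    exact exists_ne x
  obtain ⟨y, hxy, -⟩ := nb w hw
  obtain ⟨y', hxy', hne⟩ := nb y hxy.ne'
  obtain ⟨c, v, T, h1, hT, hwT, hcv, hv, -⟩ :=
    h2.reach {y'} (a := y) (b := y') (w := x) (by simpa using hne.symm) (by simp) hxy.ne' hxy'.ne'
  rw [Finset.mem_singleton] at hv
  subst hv
  have hvT : v ∉ T := by simpa using hT
  refine ⟨insert v (insert x T), ⟨v, c, .cons hxy'.symm (.cons hxy h1 hwT) ?_, hcv, ?_⟩, by simp⟩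
  · simp [hxy'.ne', hvT]
  · rw [Finset.card_insert_of_notMem (by simp [hxy'.ne', hvT]), Finset.card_insert_of_notMem hwT]
    have := Finset.card_pos.2 ⟨_, h1.left_mem⟩
    omega

lemma heavy_path (H : Finset V) (hH : ∀ x ∈ H, Hv G x) (hne : H.Nonempty) :
    ∃ a b, Pth_s14 (OA G) a b H := by
  induction hne using Finset.Nonempty.cons_induction with
  | singleton a => exact ⟨a, a, .single a⟩
  | cons a s ha hs ih =>
    obtain ⟨b, c, p⟩ := ih (fun x hx => hH x (by simp [hx]))
    rw [Finset.cons_eq_insert]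
    exact ⟨a, c, .cons (.inr ⟨hH a (by simp), hH b (by simp [p.left_mem]),
      fun e => ha (e ▸ p.left_mem)⟩) p ha⟩

lemma cyc3 {x y z : V} (h1 : G.Adj x y) (h2 : G.Adj y z) (h3 : G.Adj z x) :
    Cyc G.Adj {x, y, z} :=
  ⟨x, z, .cons h1 (.cons h2 (.single z) (by simpa using h2.ne)) (by simp [h1.ne, h3.ne']), h3, by
    rw [Finset.card_eq_three.2 ⟨x, y, z, h1.ne, h3.ne', h2.ne, rfl⟩]⟩

lemma cyc4 {x y z w : V} (h1 : G.Adj x y) (h2 : G.Adj y z) (h3 : G.Adj z w) (h4 : G.Adj w x)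
    (hxz : x ≠ z) (hyw : y ≠ w) : Cyc G.Adj {x, y, z, w} :=
  ⟨x, w, .cons h1 (.cons h2 (.cons h3 (.single w) (by simpa using h3.ne))
    (by simp [h2.ne, hyw])) (by simp [h1.ne, h4.ne', hxz]), h4, by
    rw [Finset.card_insert_of_notMem (by simp [h1.ne, h4.ne', hxz]),
      Finset.card_eq_three.2 ⟨y, z, w, h2.ne, hyw, h3.ne, rfl⟩]; omega⟩

/-- two heavy vertices lie on a cycle -/
lemma TwoConnected.cyc_two (h2 : TwoConnected G) {x y : V} (hx : Hv G x) (hy : Hv G y)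
    (hxy : x ≠ y) : ∃ S, Cyc G.Adj S ∧ x ∈ S ∧ y ∈ S := by
  have hc := h2.1
  unfold Hv at hx hy
  by_cases hw : ∃ w, G.Adj x w ∧ G.Adj y w
  · obtain ⟨w, hxw, hyw⟩ := hw
    by_cases hadj : G.Adj x y
    · exact ⟨_, cyc3 hadj hyw hxw.symm, by simp, by simp⟩
    by_cases hw' : ∃ w', w' ≠ w ∧ G.Adj x w' ∧ G.Adj y w'
    · obtain ⟨w', hne, hxw', hyw'⟩ := hw'
      exact ⟨_, cyc4 hxw hyw.symm hyw' hxw'.symm hxy hne.symm, by simp, by simp⟩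
    exfalso
    have e1 : (G.neighborFinset x ∩ G.neighborFinset y).card ≤ 1 := by
      rw [Finset.card_le_one]
      simp only [Finset.mem_inter, SimpleGraph.mem_neighborFinset]
      push Not at hw'
      intro s hs t ht
      have h1 : s = w := by by_contra h; exact hw' s h hs.1 hs.2
      have h2 : t = w := by by_contra h; exact hw' t h ht.1 ht.2
      rw [h1, h2]
    have e2 : (G.neighborFinset x ∪ G.neighborFinset y).card ≤ Fintype.card V - 2 := by
      have : G.neighborFinset x ∪ G.neighborFinset y ⊆ ({x, y} : Finset V)ᶜ := by
        intro s
        simp only [Finset.mem_union, SimpleGraph.mem_neighborFinset, Finset.mem_compl,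
          Finset.mem_insert, Finset.mem_singleton, not_or]
        rintro (h | h)
        · exact ⟨h.ne', fun e => hadj (e ▸ h)⟩
        · exact ⟨fun e => hadj (e ▸ h).symm, h.ne'⟩
      have h := Finset.card_le_card this
      rw [Finset.card_compl, Finset.card_pair hxy] at h
      exact h
    have e3 := Finset.card_union_add_card_inter (G.neighborFinset x) (G.neighborFinset y)
    simp only [SimpleGraph.card_neighborFinset_eq_degree] at e3
    omega
  · -- no common neighbour: the neighbourhoods partition `V`
    have dis : Disjoint (G.neighborFinset x) (G.neighborFinset y) := by
      rw [Finset.disjoint_left]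
      simp only [SimpleGraph.mem_neighborFinset]
      exact fun s h1 h2 => hw ⟨s, h1, h2⟩
    have hcard := Finset.card_union_of_disjoint dis
    simp only [SimpleGraph.card_neighborFinset_eq_degree] at hcard
    have huniv : G.neighborFinset x ∪ G.neighborFinset y = Finset.univ := by
      apply Finset.eq_univ_of_card
      have := Finset.card_le_univ (G.neighborFinset x ∪ G.neighborFinset y)
      omega
    have cov : ∀ s, G.Adj x s ∨ G.Adj y s := by
      intro s
      have := Finset.mem_univ s
      rw [← huniv] at this
      simpa using this
    have hadj : G.Adj x y := by
      rcases cov y with h | h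
      · exact h
      · exact absurd h (G.loopless.irrefl _)
    -- a neighbour of `y` different from `x`
    obtain ⟨s, hys, hsx⟩ : ∃ s, G.Adj y s ∧ s ≠ x := by
      have : 1 < (G.neighborFinset y).card := by
        rw [SimpleGraph.card_neighborFinset_eq_degree]; omega
      obtain ⟨s, hs, h⟩ := Finset.exists_mem_ne this x
      exact ⟨s, by simpa using hs, h⟩
    obtain ⟨c, v, T, h1, hT, hyT, hcv, hv, hvy⟩ :=
      h2.reach (G.neighborFinset x ∪ {x}) (a := s) (b := x) (w := y)
        (by
          simp only [Finset.mem_union, SimpleGraph.mem_neighborFinset, Finset.mem_singleton, not_or]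
          exact ⟨fun h => hw ⟨s, h, hys⟩, hsx⟩) (by simp) hys.ne' hxy
    have hcS := Finset.disjoint_left.1 hT h1.right_mem
    simp only [Finset.mem_union, SimpleGraph.mem_neighborFinset, Finset.mem_singleton, not_or]
      at hcS hv
    have hyc : G.Adj y c := (cov c).resolve_left hcS.1
    have hxv : G.Adj x v := by
      rcases hv with h | rfl
      · exact h
      · exact absurd hcv.symm hcS.1
    exact ⟨_, cyc4 hxv hcv.symm hyc.symm hadj.symm (Ne.symm hcS.2) hvy, by simp, by simp⟩

lemma TwoConnected.cyc_heavy (h2 : TwoConnected G) :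
    ∃ S, Cyc G.Adj S ∧ ∀ x, Hv G x → x ∈ S := by
  classical
  obtain ⟨H, memH⟩ : ∃ H : Finset V, ∀ x, x ∈ H ↔ Hv G x :=
    ⟨Finset.univ.filter (Hv G), by simp⟩
  by_cases h3 : 3 ≤ H.card
  · obtain ⟨a, b, p⟩ := heavy_path H (fun x hx => (memH x).1 hx) (Finset.card_pos.1 (by omega))
    have hab : b ≠ a := by
      rintro rfl
      cases p with
      | single => rw [Finset.card_singleton] at h3; omega
      | cons r p ha => exact ha p.right_mem
    obtain ⟨T, hT, hs⟩ := Cyc.close (G := G) (S := H) ⟨a, b, p,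
      .inr ⟨(memH _).1 p.right_mem, (memH _).1 p.left_mem, hab⟩, h3⟩
    exact ⟨T, hT, fun x hx => hs ((memH x).2 hx)⟩
  · by_cases h1 : H.card ≤ 1
    · obtain ⟨x, hx⟩ : ∃ x, ∀ y ∈ H, y = x := by
        rcases H.eq_empty_or_nonempty with h | ⟨x, hx⟩
        · have hc := h2.1
          obtain ⟨x⟩ : Nonempty V := Fintype.card_pos_iff.1 (by omega)
          exact ⟨x, by simp [h]⟩
        · exact ⟨x, fun y hy => Finset.card_le_one.1 h1 y hy x hx⟩
      obtain ⟨S, hS, hxS⟩ := h2.cyc_mem x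
      exact ⟨S, hS, fun y hy => by rw [hx y ((memH y).2 hy)]; exact hxS⟩
    · obtain ⟨x, y, hxy, he⟩ := Finset.card_eq_two.1 (show H.card = 2 by omega)
      obtain ⟨S, hS, hx, hy⟩ := h2.cyc_two ((memH x).1 (by simp [he])) ((memH y).1 (by simp [he]))
        hxy
      refine ⟨S, hS, fun w hw => ?_⟩
      have := (memH w).2 hw
      rw [he] at this
      simp only [Finset.mem_insert, Finset.mem_singleton] at this
      rcases this with rfl | rfl <;> assumption

lemma Pth_s14.toWalk {a b : V} {S : Finset V} (h : Pth_s14 G.Adj a b S) :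
    ∃ w : G.Walk a b, w.IsPath ∧ (∀ x, x ∈ w.support ↔ x ∈ S) ∧ w.length + 1 = S.card := by
  induction h with
  | single a => exact ⟨.nil, by simp, by simp, by simp⟩
  | cons r p ha ih =>
    obtain ⟨w, h1, h2, h3⟩ := ih
    refine ⟨.cons r w, ?_, ?_, ?_⟩
    · rw [SimpleGraph.Walk.cons_isPath_iff]; exact ⟨h1, fun h => ha ((h2 _).1 h)⟩
    · intro x; simp [h2]
    · rw [Finset.card_insert_of_notMem ha, SimpleGraph.Walk.length_cons, h3]

lemma Cyc.hamiltonian {S : Finset V} (h : Cyc G.Adj S) (hS : ∀ x, x ∈ S) :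
    IsHamiltonianGraph G := by
  obtain ⟨a, b, p, hba, h3⟩ := h
  obtain ⟨w, h1, h2, h4⟩ := p.toWalk
  refine ⟨b, .cons hba w, ?_, ?_⟩
  · rw [SimpleGraph.Walk.isCycle_iff_isPath_tail_and_le_length]
    refine ⟨by simpa using h1, ?_⟩
    rw [SimpleGraph.Walk.length_cons]; omega
  · intro u; simp [h2, hS]

end final

theorem hamiltonian_of_claw_Z2_f_heavy {V : Type} [Fintype V] (G : SimpleGraph V)
    [DecidableRel G.Adj] (h2 : TwoConnected G)
    (hclaw : FHeavy G claw) (hZ2 : FHeavy G (Zgraph 2)) :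
    IsHamiltonianGraph G := by
  classical
  have hC := clawC_of hclaw
  have hZ := zC_of hZ2
  -- a largest cycle through all heavy vertices
  obtain ⟨S₀, hS₀⟩ := h2.cyc_heavy
  obtain ⟨S, hS, hmax⟩ := Finset.exists_max_image
    (Finset.univ.filter fun S : Finset V => Cyc G.Adj S ∧ ∀ x, Hv G x → x ∈ S) Finset.card
    ⟨S₀, by simpa using hS₀⟩
  simp only [Finset.mem_filter, Finset.mem_univ, true_and] at hS hmax
  obtain ⟨hcyc, hH⟩ := hS
  have h3 : 3 ≤ S.card := by obtain ⟨a, b, -, -, h⟩ := hcyc; exact h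
  have hm : MaxO G S := by
    refine ⟨h3, fun T hT hST => ?_⟩
    obtain ⟨T', hT', hTT'⟩ := hT.close
    have h1 := hmax T' ⟨hT', fun x hx => hTT' (hST (hH x hx))⟩
    have h4 := Finset.eq_of_subset_of_card_le (hST.trans hTT') h1
    rw [h4]; exact hTT'
  by_contra hnot
  obtain ⟨x, hx⟩ : ∃ x, x ∉ S := by
    by_contra h
    push Not at h
    exact hnot (hcyc.hamiltonian h)
  -- a shortest ear
  have hex : ∃ n, ∃ u v p q T, Ear G S u v p q T ∧ T.card = n := by
    obtain ⟨u, v, p, q, T, he⟩ := h2.exists_ear h3 hx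
    exact ⟨_, u, v, p, q, T, he, rfl⟩
  obtain ⟨u, v, p, q, T, he, hcard⟩ := Nat.find_spec hex
  refine main_contra hC hZ hcyc hm hH he fun u v p q T' he' => ?_
  rw [hcard]
  exact Nat.find_min' hex ⟨u, v, p, q, T', he', rfl⟩
end
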